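/- Let n ≥ 1 and let u : ℝⁿ → ℝⁿ be a divergence-free Schwartz vector field. There exist a constant c > 0 (depending only on n and φ) and a nonnegative sequence (d_k)_{k∈ℤ} with Σ_{k∈ℤ} d_k = 1 such that for every k ∈ ℤ, ‖Δ_k((u·∇)u) − Σᵢ (Ṡ_{k−1}uᵢ)·∂ᵢ(Δ_k u)‖_{L²} ≤ c·d_k·2^{−k(n/2+1)}·‖u‖²_{Ḃ^{n/2+1}_{2,1}}. -/

import Mathlib

open MeasureTheory Filter SchwartzMap
open scoped FourierTransform

noncomputable section

abbrev Ell (n : ℕ) := EuclideanSpace ℝ (Fin n)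

def eVec (n : ℕ) (i : Fin n) : Ell n := EuclideanSpace.single i 1

/-- coercion of a real-valued function to a complex-valued one -/
def cf {n : ℕ} (f : Ell n → ℝ) : Ell n → ℂ := fun x => (f x : ℂ)

/-- the Fourier multiplier operator `Λ^s` with symbol `|ξ|^s` -/
def Lam {n : ℕ} (s : ℝ) (f : Ell n → ℂ) : Ell n → ℂ :=
  𝓕⁻ (fun ξ => ((‖ξ‖ ^ s : ℝ) : ℂ) * 𝓕 f ξ)

/-- the partial derivative `∂ᵢ` -/
def pd {n : ℕ} (i : Fin n) (f : Ell n → ℂ) : Ell n → ℂ :=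
  fun x => fderiv ℝ f x (eVec n i)

/-- the advection term `(v·∇)w` for complex vector fields -/
def adv {n : ℕ} (v w : Fin n → Ell n → ℂ) : Fin n → Ell n → ℂ :=
  fun l x => ∑ i, v i x * pd i (w l) x

/-- squared homogeneous Sobolev norm of a complex scalar function -/
def HsqC {n : ℕ} (s : ℝ) (f : Ell n → ℂ) : ℝ :=
  ∫ ξ, ‖ξ‖ ^ (2 * s) * ‖𝓕 f ξ‖ ^ 2

/-- homogeneous Sobolev norm `‖u‖_{Ḣ^s}` of a real vector field -/
def Hnorm {n : ℕ} (s : ℝ) (u : Fin n → Ell n → ℝ) : ℝ :=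
  Real.sqrt (∑ l, HsqC s (cf (u l)))

/-- `L²` norm of a complex vector field -/
def vL2 {n : ℕ} (f : Fin n → Ell n → ℂ) : ℝ :=
  Real.sqrt (∑ l, ∫ x, ‖f l x‖ ^ 2)

/-- `L²` pairing `⟨f,g⟩ = Σ_l ∫ f_l g_l` of complex vector fields -/
def Cinner {n : ℕ} (f g : Fin n → Ell n → ℂ) : ℂ :=
  ∑ l, ∫ x, f l x * g l x

/-- The standing assumptions on the Littlewood–Paley function `φ`: a smooth,
radial, compactly supported function with values in `[0,1]`, supported in the
annulus `{3/4 ≤ |ξ| ≤ 8/3}`, with `Σ_{j∈ℤ} φ(2^{−j}ξ) = 1` for `ξ ≠ 0` and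
`φ(2^{−j}·), φ(2^{−j'}·)` having disjoint supports when `|j−j'| ≥ 2`. -/
def LPFunction {n : ℕ} (φ : Ell n → ℝ) : Prop :=
  ContDiff ℝ (⊤ : ℕ∞) φ ∧ HasCompactSupport φ ∧
  (∀ ξ, φ ξ ≠ 0 → 3 / 4 ≤ ‖ξ‖ ∧ ‖ξ‖ ≤ 8 / 3) ∧
  (∀ ξ, φ ξ ∈ Set.Icc (0 : ℝ) 1) ∧
  (∀ ξ η : Ell n, ‖ξ‖ = ‖η‖ → φ ξ = φ η) ∧
  (∀ ξ : Ell n, ξ ≠ 0 → (∑' j : ℤ, φ ((2 : ℝ) ^ (-j) • ξ)) = 1) ∧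
  (∀ j j' : ℤ, 2 ≤ |j - j'| → ∀ ξ : Ell n,
    φ ((2 : ℝ) ^ (-j) • ξ) * φ ((2 : ℝ) ^ (-j') • ξ) = 0)

/-- the homogeneous dyadic block `Δ_j u = 𝓕⁻¹(φ(2^{−j}ξ) û(ξ))` -/
def DeltaJ {n : ℕ} (φ : Ell n → ℝ) (j : ℤ) (f : Ell n → ℂ) : Ell n → ℂ :=
  𝓕⁻ (fun ξ => ((φ ((2 : ℝ) ^ (-j) • ξ) : ℝ) : ℂ) * 𝓕 f ξ)

/-- the homogeneous cutoff `Ṡ_j u = Σ_{j' ≤ j−1} Δ_{j'} u` -/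
def SJ {n : ℕ} (φ : Ell n → ℝ) (j : ℤ) (f : Ell n → ℂ) : Ell n → ℂ :=
  fun x => ∑' j' : ℤ, if j' ≤ j - 1 then DeltaJ φ j' f x else 0

/-- `L²` norm of `Δ_j u` for a real vector field `u` -/
def DeltaL2 {n : ℕ} (φ : Ell n → ℝ) (j : ℤ) (u : Fin n → Ell n → ℝ) : ℝ :=
  Real.sqrt (∑ l, ∫ x, ‖DeltaJ φ j (cf (u l)) x‖ ^ 2)

/-- the homogeneous Besov norm `‖u‖_{Ḃ^s_{2,1}} = Σ_{j∈ℤ} 2^{js} ‖Δ_j u‖_{L²}` -/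
def Bnorm {n : ℕ} (φ : Ell n → ℝ) (s : ℝ) (u : Fin n → Ell n → ℝ) : ℝ :=
  ∑' j : ℤ, (2 : ℝ) ^ ((j : ℝ) * s) * DeltaL2 φ j u

/-- A vector field is divergence free: `Σᵢ ∂ᵢuᵢ = 0`. -/
def DivFree {n : ℕ} (u : Fin n → 𝓢(Ell n, ℝ)) : Prop :=
  ∀ x, ∑ i, fderiv ℝ (fun y => u i y) x (eVec n i) = 0

open scoped ENNReal NNReal ContDiff LineDeriv

namespace LPFunction

variable {n : ℕ} {φ : Ell n → ℝ}

lemma contDiff (hφ : LPFunction φ) : ContDiff ℝ ∞ φ := hφ.1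

lemma nonneg (hφ : LPFunction φ) (ξ : Ell n) : 0 ≤ φ ξ := (hφ.2.2.2.1 ξ).1

lemma le_one (hφ : LPFunction φ) (ξ : Ell n) : φ ξ ≤ 1 := (hφ.2.2.2.1 ξ).2

lemma annulus (hφ : LPFunction φ) {ξ : Ell n} (h : φ ξ ≠ 0) : 3 / 4 ≤ ‖ξ‖ ∧ ‖ξ‖ ≤ 8 / 3 :=
  hφ.2.2.1 ξ h

lemma tsum_eq_one (hφ : LPFunction φ) {ξ : Ell n} (h : ξ ≠ 0) :
    ∑' j : ℤ, φ ((2 : ℝ) ^ (-j) • ξ) = 1 := hφ.2.2.2.2.2.1 ξ h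

lemma norm_two_zpow_smul (j : ℤ) (ξ : Ell n) : ‖(2 : ℝ) ^ j • ξ‖ = (2 : ℝ) ^ j * ‖ξ‖ := by
  rw [norm_smul, Real.norm_of_nonneg (by positivity)]

lemma annulus_dilate (hφ : LPFunction φ) {j : ℤ} {ξ : Ell n}
    (h : φ ((2 : ℝ) ^ (-j) • ξ) ≠ 0) :
    3 / 4 * (2 : ℝ) ^ j ≤ ‖ξ‖ ∧ ‖ξ‖ ≤ 8 / 3 * (2 : ℝ) ^ j := by
  have h2 := hφ.annulus h
  rw [norm_two_zpow_smul, zpow_neg, inv_mul_eq_div, le_div_iff₀ (by positivity),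
    div_le_iff₀ (by positivity)] at h2
  exact h2

/-- Terms of the dyadic partition of unity more than one index apart are not both nonzero. -/
lemma eq_zero_of_ne (hφ : LPFunction φ) {i j : ℤ} (hij : 2 ≤ |i - j|) {ξ : Ell n}
    (h : φ ((2 : ℝ) ^ (-j) • ξ) ≠ 0) : φ ((2 : ℝ) ^ (-i) • ξ) = 0 :=
  (mul_eq_zero.mp (hφ.2.2.2.2.2.2 i j hij ξ)).resolve_right h

lemma hasSum (hφ : LPFunction φ) {ξ : Ell n} (h : ξ ≠ 0) :
    HasSum (fun j : ℤ => φ ((2 : ℝ) ^ (-j) • ξ)) 1 := by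
  have hs : Summable (fun j : ℤ => φ ((2 : ℝ) ^ (-j) • ξ)) := by
    by_contra hc
    have := hφ.tsum_eq_one h
    rw [tsum_eq_zero_of_not_summable hc] at this
    exact zero_ne_one this
  exact hφ.tsum_eq_one h ▸ hs.hasSum

/-- At every nonzero frequency some term of the partition of unity is at least `1/3`. -/
lemma exists_third_le (hφ : LPFunction φ) {ξ : Ell n} (h : ξ ≠ 0) :
    ∃ j : ℤ, 1 / 3 ≤ φ ((2 : ℝ) ^ (-j) • ξ) := by
  obtain ⟨j, hj⟩ : ∃ j : ℤ, φ ((2 : ℝ) ^ (-j) • ξ) ≠ 0 := by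
    by_contra! hc
    have := hφ.tsum_eq_one h
    simp only [hc, tsum_zero, zero_ne_one] at this
  have h1 := hφ.tsum_eq_one h
  rw [tsum_eq_sum (s := {j - 1, j, j + 1})
    (fun i hi => hφ.eq_zero_of_ne (by simp at hi; grind) hj),
    Finset.sum_insert (by simp; omega), Finset.sum_pair (by simp)] at h1
  by_contra! hc
  linarith [hc (j - 1), hc j, hc (j + 1)]

/-- On `4/3 < |ξ| < 3/2` only one term of the partition of unity is nonzero. -/
lemma eq_one (hφ : LPFunction φ) {ξ : Ell n} (h1 : 4 / 3 < ‖ξ‖) (h2 : ‖ξ‖ < 3 / 2) :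
    φ ξ = 1 := by
  have h0 : ξ ≠ 0 := by
    rintro rfl
    norm_num at h1
  have h3 := hφ.tsum_eq_one h0
  rw [tsum_eq_single 0] at h3
  · simpa using h3
  · intro j hj
    by_contra hc
    have h4 := hφ.annulus_dilate hc
    rcases lt_or_gt_of_ne hj with hj | hj
    · have : (2 : ℝ) ^ j ≤ 2 ^ (-1 : ℤ) := zpow_le_zpow_right₀ (by norm_num) (by omega)
      norm_num at this
      linarith
    · have : (2 : ℝ) ^ (1 : ℤ) ≤ 2 ^ j := zpow_le_zpow_right₀ (by norm_num) (by omega)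
      norm_num at this
      linarith

end LPFunction

/-- The low-frequency cutoff `Σ_{j ≤ 0} φ(2^{-j}ξ)`, extended smoothly to the origin. -/
def lowCutoff {n : ℕ} (φ : Ell n → ℝ) (ξ : Ell n) : ℝ := if ‖ξ‖ < 3 / 2 then 1 else φ ξ

namespace LPFunction

variable {n : ℕ} {φ : Ell n → ℝ}

lemma lowCutoff_eq (hφ : LPFunction φ) {ξ : Ell n} (h : 4 / 3 < ‖ξ‖) :
    lowCutoff φ ξ = φ ξ := by
  unfold lowCutoff
  split_ifs with h2
  · rw [hφ.eq_one h h2]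
  · rfl

lemma lowCutoff_nonneg (hφ : LPFunction φ) (ξ : Ell n) : 0 ≤ lowCutoff φ ξ := by
  unfold lowCutoff
  split_ifs
  exacts [zero_le_one, hφ.nonneg ξ]

lemma lowCutoff_le_one (hφ : LPFunction φ) (ξ : Ell n) : lowCutoff φ ξ ≤ 1 := by
  unfold lowCutoff
  split_ifs
  exacts [le_rfl, hφ.le_one ξ]

lemma contDiff_lowCutoff (hφ : LPFunction φ) : ContDiff ℝ ∞ (lowCutoff φ) := by
  rw [contDiff_iff_contDiffAt]
  intro ξ
  rcases lt_or_ge ‖ξ‖ (3 / 2) with h | h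
  · refine (contDiffAt_const (c := (1 : ℝ))).congr_of_eventuallyEq ?_
    filter_upwards [(isOpen_lt continuous_norm continuous_const).mem_nhds h] with η hη
    exact if_pos hη
  · refine hφ.contDiff.contDiffAt.congr_of_eventuallyEq ?_
    have h' : 4 / 3 < ‖ξ‖ := by linarith
    filter_upwards [(isOpen_lt continuous_const continuous_norm).mem_nhds h'] with η hη
    exact hφ.lowCutoff_eq hη

lemma hasCompactSupport_lowCutoff (hφ : LPFunction φ) : HasCompactSupport (lowCutoff φ) := by
  refine HasCompactSupport.intro (isCompact_closedBall (0 : Ell n) (8 / 3)) fun ξ hξ => ?_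
  rw [mem_closedBall_zero_iff, not_le] at hξ
  rw [hφ.lowCutoff_eq (by linarith)]
  by_contra hc
  linarith [(hφ.annulus hc).2]

lemma hasSum_lowCutoff (hφ : LPFunction φ) (m : ℤ) {ξ : Ell n} (h : ξ ≠ 0) :
    HasSum (fun j : ℤ => if j ≤ m then φ ((2 : ℝ) ^ (-j) • ξ) else 0)
      (lowCutoff φ ((2 : ℝ) ^ (-m) • ξ)) := by
  have hm : (0 : ℝ) < 2 ^ m := by positivity
  have hn : ‖(2 : ℝ) ^ (-m) • ξ‖ = ‖ξ‖ / 2 ^ m := by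
    rw [norm_two_zpow_smul, zpow_neg, inv_mul_eq_div]
  unfold lowCutoff
  simp only [hn, div_lt_iff₀ hm]
  split_ifs with h2
  · convert hφ.hasSum h using 2 with j
    split_ifs with hj
    · rfl
    · by_contra hc
      have h4 := hφ.annulus_dilate (Ne.symm hc)
      have : (2 : ℝ) ^ (m + 1) ≤ 2 ^ j := zpow_le_zpow_right₀ (by norm_num) (by omega)
      rw [zpow_add_one₀ (by norm_num)] at this
      linarith
  · convert hasSum_single (f := fun j : ℤ => if j ≤ m then φ ((2 : ℝ) ^ (-j) • ξ) else 0) m ?_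
    · simp
    · intro j hj
      split_ifs with hj2
      · by_contra hc
        have h4 := hφ.annulus_dilate hc
        have : (2 : ℝ) ^ j ≤ 2 ^ (m - 1) := zpow_le_zpow_right₀ (by norm_num) (by omega)
        rw [zpow_sub_one₀ (by norm_num)] at this
        linarith
      · rfl

/-- The symbol of the commutator, times `|η|`, is controlled by `|ξ - η|` on high `η` and by `|η|`
on high `ξ - η`. -/
lemma exists_symbol_bound (hφ : LPFunction φ) : ∃ C : ℝ≥0, ∀ ξ η : Ell n,
    |φ ξ - lowCutoff φ ((4 : ℝ) • (ξ - η)) * φ η| * ‖η‖ ≤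
      C * ((if 3 / 8 ≤ ‖η‖ then ‖ξ - η‖ else 0) + (if 3 / 8 ≤ ‖ξ - η‖ then ‖η‖ else 0)) := by
  obtain ⟨L, hL⟩ := ContDiff.lipschitzWith_of_hasCompactSupport hφ.2.1 hφ.contDiff (by simp)
  refine ⟨4 * L + 1, fun ξ η => ?_⟩
  have hC : (1 : ℝ) ≤ ((4 * L + 1 : ℝ≥0) : ℝ) := by push_cast; linarith [L.2]
  rcases le_or_gt (3 / 8) ‖ξ - η‖ with hp | hp
  · rw [if_pos hp]
    have hm : |φ ξ - lowCutoff φ ((4 : ℝ) • (ξ - η)) * φ η| ≤ 1 := by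
      rw [abs_le]
      have h1 := mul_nonneg (hφ.lowCutoff_nonneg ((4 : ℝ) • (ξ - η))) (hφ.nonneg η)
      have h2 := mul_le_one₀ (hφ.lowCutoff_le_one ((4 : ℝ) • (ξ - η))) (hφ.nonneg η) (hφ.le_one η)
      constructor <;> linarith [hφ.nonneg ξ, hφ.le_one ξ]
    have h3 : 0 ≤ (if 3 / 8 ≤ ‖η‖ then ‖ξ - η‖ else 0) := by positivity
    exact mul_le_mul (hm.trans hC) (by linarith) (norm_nonneg _) (by positivity)
  · have h1 : lowCutoff φ ((4 : ℝ) • (ξ - η)) = 1 := by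
      refine if_pos ?_
      rw [norm_smul]
      norm_num
      linarith
    rw [h1, one_mul, if_neg hp.not_ge, add_zero]
    by_cases h0 : φ ξ = 0 ∧ φ η = 0
    · rw [h0.1, h0.2]
      simp only [sub_zero, abs_zero, zero_mul]
      positivity
    · have h4 : 3 / 8 ≤ ‖η‖ ∧ ‖η‖ ≤ 4 := by
        rcases not_and_or.mp h0 with h | h
        · have := hφ.annulus h
          have h5 := norm_sub_norm_le ξ η
          have h6 := norm_sub_norm_le η ξ
          rw [norm_sub_rev] at h6
          constructor <;> linarith
        · have := hφ.annulus h
          constructor <;> linarith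
      rw [if_pos h4.1]
      have h5 : |φ ξ - φ η| ≤ L * ‖ξ - η‖ := by
        simpa [Real.dist_eq, dist_eq_norm] using hL.dist_le_mul ξ η
      calc |φ ξ - φ η| * ‖η‖ ≤ L * ‖ξ - η‖ * 4 := by gcongr; exact h4.2
        _ ≤ ((4 * L + 1 : ℝ≥0) : ℝ) * ‖ξ - η‖ := by
          push_cast
          nlinarith [norm_nonneg (ξ - η)]

end LPFunction

/-- The pointwise product of two complex Schwartz functions. -/
def schwartzMul {n : ℕ} (f g : 𝓢(Ell n, ℂ)) : 𝓢(Ell n, ℂ) :=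
  pairing (ContinuousLinearMap.mul ℂ ℂ) f g

@[simp]
lemma schwartzMul_apply {n : ℕ} (f g : 𝓢(Ell n, ℂ)) (x : Ell n) :
    schwartzMul f g x = f x * g x := rfl

lemma fourier_schwartzMul {n : ℕ} (f g : 𝓢(Ell n, ℂ)) (ξ : Ell n) :
    𝓕 (schwartzMul f g) ξ = ∫ η, 𝓕 f (ξ - η) * 𝓕 g η := by
  have h1 : 𝓕⁻ (schwartzMul f g) =
      SchwartzMap.convolution (ContinuousLinearMap.mul ℂ ℂ) (𝓕⁻ f) (𝓕⁻ g) := by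
    simp [SchwartzMap.convolution, schwartzMul]
  have h2 (h : 𝓢(Ell n, ℂ)) (x : Ell n) : 𝓕 h x = 𝓕⁻ h (-x) := by
    simp [fourierInv_apply_eq]
  rw [h2, h1, SchwartzMap.convolution_apply, MeasureTheory.convolution_def]
  simp only [h2, ContinuousLinearMap.mul_apply']
  rw [← integral_add_left_eq_self _ (-ξ)]
  refine integral_congr_ae (.of_forall fun η => ?_)
  simp only
  congr 2 <;> abel_nf

/-- The partial derivative as a Fourier multiplier. -/
lemma fourier_lineDeriv_eVec {n : ℕ} (f : 𝓢(Ell n, ℂ)) (i : Fin n) (η : Ell n) :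
    𝓕 (∂_{eVec n i} f) η = 2 * Real.pi * Complex.I * (η i : ℂ) * 𝓕 f η := by
  rw [fourier_lineDerivOp_eq]
  have : (inner ℝ · (eVec n i)).HasTemperateGrowth := ((innerSL ℝ).flip _).hasTemperateGrowth
  rw [_root_.smul_apply, smulLeftCLM_apply_apply this]
  simp [eVec, EuclideanSpace.inner_single_right, mul_assoc]

lemma pd_coe {n : ℕ} (f : 𝓢(Ell n, ℂ)) (i : Fin n) : pd i f = ∂_{eVec n i} f := rfl

/-- A real Schwartz function seen as a complex one. -/
def complexify {n : ℕ} (f : 𝓢(Ell n, ℝ)) : 𝓢(Ell n, ℂ) := f.postcompCLM Complex.ofRealCLM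

lemma complexify_apply {n : ℕ} (f : 𝓢(Ell n, ℝ)) (x : Ell n) : complexify f x = (f x : ℂ) := rfl

lemma cf_coe {n : ℕ} (f : 𝓢(Ell n, ℝ)) : cf f = complexify f := rfl

lemma lineDeriv_complexify {n : ℕ} (f : 𝓢(Ell n, ℝ)) (v x : Ell n) :
    ∂_{v} (complexify f) x = ((fderiv ℝ (fun y => f y) x v : ℝ) : ℂ) := by
  rw [lineDerivOp_apply_eq_fderiv]
  have h : HasFDerivAt (complexify f) (Complex.ofRealCLM.comp (fderiv ℝ f x)) x :=
    Complex.ofRealCLM.hasFDerivAt.comp x (f.hasFDerivAt x)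
  rw [h.fderiv]
  rfl

lemma cf_advection {n : ℕ} (u : Fin n → 𝓢(Ell n, ℝ)) (l : Fin n) :
    cf (fun y => ∑ i, u i y * fderiv ℝ (fun z => u l z) y (eVec n i)) =
      (∑ i, schwartzMul (complexify (u i)) (∂_{eVec n i} (complexify (u l))) : 𝓢(Ell n, ℂ)) := by
  ext x
  simp [cf, lineDeriv_complexify, complexify_apply]

namespace LPFunction

variable {n : ℕ} {φ : Ell n → ℝ}

/-- A dilate `χ(2^{-j}·)` of a smooth compactly supported function as a Schwartz function. -/
def dilate {χ : Ell n → ℝ} (hs : HasCompactSupport χ) (hc : ContDiff ℝ ∞ χ) (j : ℤ) :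
    𝓢(Ell n, ℂ) :=
  complexify (HasCompactSupport.toSchwartzMap (f := fun ξ => χ ((2 : ℝ) ^ (-j) • ξ))
    (hs.comp_smul (by positivity)) (by fun_prop))

@[simp]
lemma dilate_apply {χ : Ell n → ℝ} (hs : HasCompactSupport χ) (hc : ContDiff ℝ ∞ χ) (j : ℤ)
    (ξ : Ell n) : dilate hs hc j ξ = (χ ((2 : ℝ) ^ (-j) • ξ) : ℂ) := rfl

/-- The dyadic block of a Schwartz function as a Schwartz function. -/
lemma deltaJ_coe (hφ : LPFunction φ) (j : ℤ) (f : 𝓢(Ell n, ℂ)) :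
    DeltaJ φ j f = 𝓕⁻ (schwartzMul (dilate hφ.2.1 hφ.contDiff j) (𝓕 f)) := by
  rw [fourierInv_coe]
  rfl

/-- The low-frequency cutoff of a Schwartz function as a Schwartz function. -/
lemma sJ_coe [NeZero n] (hφ : LPFunction φ) (k : ℤ) (f : 𝓢(Ell n, ℂ)) :
    SJ φ k f = 𝓕⁻ (schwartzMul
      (dilate hφ.hasCompactSupport_lowCutoff hφ.contDiff_lowCutoff (k - 1)) (𝓕 f)) := by
  rw [fourierInv_coe]
  ext x
  unfold SJ DeltaJ
  simp only [Real.fourierInv_eq]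
  set c : Ell n → ℂ := fun ξ => (Real.fourierChar (inner ℝ ξ x) : ℂ) * 𝓕 f ξ with hc
  have hci : Integrable c := by
    refine (𝓕 f).integrable.norm.mono' ?_ (.of_forall fun ξ => ?_)
    · exact Continuous.aestronglyMeasurable (by fun_prop)
    · simp only [hc, norm_mul, Circle.norm_coe, one_mul, le_refl]
  have key : HasSum
      (fun j : ℤ => ∫ ξ, ((if j ≤ k - 1 then φ ((2 : ℝ) ^ (-j) • ξ) else 0 : ℝ) : ℂ) * c ξ)
      (∫ ξ, (lowCutoff φ ((2 : ℝ) ^ (-(k - 1)) • ξ) : ℂ) * c ξ) := by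
    have hφc : Continuous φ := hφ.contDiff.continuous
    have hXc : Continuous (lowCutoff φ) := hφ.contDiff_lowCutoff.continuous
    have hsum {ξ : Ell n} (h : ξ ≠ 0) := hφ.hasSum_lowCutoff (k - 1) h
    refine hasSum_integral_of_dominated_convergence
      (fun j ξ => (if j ≤ k - 1 then φ ((2 : ℝ) ^ (-j) • ξ) else 0) * ‖c ξ‖) ?_ ?_ ?_ ?_ ?_
    · intro j
      refine AEStronglyMeasurable.mul ?_ hci.aestronglyMeasurable
      split_ifs
      · exact Continuous.aestronglyMeasurable (by fun_prop)
      · exact aestronglyMeasurable_const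
    · refine fun j => .of_forall fun ξ => ?_
      rw [norm_mul, Complex.norm_real, Real.norm_of_nonneg]
      split_ifs
      exacts [hφ.nonneg _, le_rfl]
    · filter_upwards [Measure.ae_ne volume (0 : Ell n)] with ξ h
      exact (hsum h).summable.mul_right _
    · refine Integrable.congr (f := fun ξ => lowCutoff φ ((2 : ℝ) ^ (-(k - 1)) • ξ) * ‖c ξ‖) ?_ ?_
      · refine hci.norm.mono' ?_ (.of_forall fun ξ => ?_)
        · exact AEStronglyMeasurable.mul (Continuous.aestronglyMeasurable (by fun_prop))
            hci.aestronglyMeasurable.norm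
        · rw [norm_mul, norm_norm, Real.norm_of_nonneg (hφ.lowCutoff_nonneg _)]
          exact mul_le_of_le_one_left (norm_nonneg _) (hφ.lowCutoff_le_one _)
      · filter_upwards [Measure.ae_ne volume (0 : Ell n)] with ξ h
        exact ((hsum h).mul_right _).tsum_eq.symm
    · filter_upwards [Measure.ae_ne volume (0 : Ell n)] with ξ h
      exact (Complex.hasSum_ofReal.mpr (hsum h)).mul_right _
  convert key.tsum_eq using 1
  · refine tsum_congr fun j => ?_
    split_ifs with hj
    · refine integral_congr_ae (.of_forall fun ξ => ?_)
      simp [hc, Circle.smul_def, fourier_coe]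
      ring
    · simp
  · refine integral_congr_ae (.of_forall fun ξ => ?_)
    simp [hc, Circle.smul_def]
    ring

end LPFunction

/-- The Cauchy–Schwarz inequality for lower Lebesgue integrals. -/
lemma sq_lintegral_mul_le {α : Type*} [MeasurableSpace α] {μ : Measure α} {f g : α → ℝ≥0∞}
    (hf : AEMeasurable f μ) (hg : AEMeasurable g μ) :
    (∫⁻ x, f x * g x ∂μ) ^ 2 ≤ (∫⁻ x, f x ^ 2 ∂μ) * ∫⁻ x, g x ^ 2 ∂μ := by
  have h := ENNReal.lintegral_mul_le_Lp_mul_Lq μ Real.HolderConjugate.two_two hf hg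
  simp only [Pi.mul_apply, ENNReal.rpow_two] at h
  refine (pow_le_pow_left' h 2).trans_eq ?_
  rw [mul_pow, ← ENNReal.rpow_mul_natCast, ← ENNReal.rpow_mul_natCast]
  norm_num

/-- Young's convolution inequality `L¹ * L² ⊆ L²`. -/
lemma lintegral_sq_convolution_le {n : ℕ} {G H : Ell n → ℝ≥0∞} (hG : Measurable G)
    (hH : Measurable H) :
    ∫⁻ ξ, (∫⁻ η, G (ξ - η) * H η) ^ 2 ≤ (∫⁻ ξ, G ξ) ^ 2 * ∫⁻ ξ, H ξ ^ 2 := by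
  have h1 (ξ : Ell n) : (∫⁻ η, G (ξ - η) * H η) ^ 2 ≤
      (∫⁻ p, G p) * ∫⁻ η, G (ξ - η) * H η ^ 2 := by
    have hs (x : ℝ≥0∞) : (x ^ (1 / 2 : ℝ)) ^ 2 = x := by
      rw [← ENNReal.rpow_mul_natCast]
      norm_num
    have h := sq_lintegral_mul_le (μ := (volume : Measure (Ell n)))
      (f := fun η => G (ξ - η) ^ (1 / 2 : ℝ))
      (g := fun η => G (ξ - η) ^ (1 / 2 : ℝ) * H η) (by fun_prop) (by fun_prop)
    simp only [← mul_assoc, ← sq, mul_pow, hs] at h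
    rwa [lintegral_sub_left_eq_self G ξ] at h
  calc ∫⁻ ξ, (∫⁻ η, G (ξ - η) * H η) ^ 2
      ≤ ∫⁻ ξ, (∫⁻ p, G p) * ∫⁻ η, G (ξ - η) * H η ^ 2 := lintegral_mono h1
    _ = (∫⁻ p, G p) * ∫⁻ ξ, ∫⁻ η, G (ξ - η) * H η ^ 2 := by
      rw [lintegral_const_mul]
      exact Measurable.lintegral_prod_right
        (f := fun ξ η => G (ξ - η) * H η ^ 2) (by unfold Function.uncurry; fun_prop)
    _ = (∫⁻ p, G p) * ∫⁻ η, ∫⁻ ξ, G (ξ - η) * H η ^ 2 := by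
      rw [lintegral_lintegral_swap]
      exact Measurable.aemeasurable (by unfold Function.uncurry; fun_prop)
    _ = (∫⁻ ξ, G ξ) ^ 2 * ∫⁻ ξ, H ξ ^ 2 := by
      have (η : Ell n) : ∫⁻ ξ, G (ξ - η) * H η ^ 2 = (∫⁻ p, G p) * H η ^ 2 := by
        rw [lintegral_mul_const _ (by fun_prop), lintegral_sub_right_eq_self G η]
      simp_rw [this]
      rw [lintegral_const_mul _ (by fun_prop), sq, mul_assoc]

lemma ENNReal.sq_sum_le {ι : Type*} (s : Finset ι) (f : ι → ℝ≥0∞) :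
    (∑ i ∈ s, f i) ^ 2 ≤ s.card * ∑ i ∈ s, f i ^ 2 := by
  have h := ENNReal.rpow_sum_le_const_mul_sum_rpow s f (p := 2) (by norm_num)
  norm_num at h
  exact h

lemma ENNReal.tsum_sq_le {ι : Type*} (f : ι → ℝ≥0∞) : ∑' i, f i ^ 2 ≤ (∑' i, f i) ^ 2 := by
  rw [sq, ← ENNReal.tsum_mul_right]
  refine ENNReal.tsum_le_tsum fun i => ?_
  rw [sq]
  gcongr
  exact ENNReal.le_tsum i

lemma enorm_le_three_mul {r : ℝ} (hr : 1 / 3 ≤ r) (z : ℂ) : ‖z‖ₑ ≤ 3 * ‖(r : ℂ) * z‖ₑ := by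
  have h3 : (3 : ℝ≥0∞) = ‖(3 : ℂ)‖ₑ := by simp [← ofReal_norm]
  rw [h3, ← enorm_mul, enorm_le_iff_norm_le, norm_mul, norm_mul, Complex.norm_real,
    Real.norm_of_nonneg (by linarith), ← mul_assoc]
  refine le_mul_of_one_le_left (norm_nonneg z) ?_
  norm_num
  linarith

/-- Plancherel's identity for the `L²` norm of a Schwartz vector field. -/
lemma ofReal_vL2_sq {n : ℕ} (f : Fin n → 𝓢(Ell n, ℂ)) :
    ENNReal.ofReal (vL2 fun l => f l) ^ 2 = ∑ l, ∫⁻ ξ, ‖𝓕 (f l) ξ‖ₑ ^ 2 := by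
  have hn (l : Fin n) : 0 ≤ ∫ x, ‖f l x‖ ^ 2 := integral_nonneg fun x => by positivity
  rw [vL2, ← ENNReal.ofReal_pow (Real.sqrt_nonneg _),
    Real.sq_sqrt (Finset.sum_nonneg fun l _ => hn l), ENNReal.ofReal_sum_of_nonneg fun l _ => hn l]
  refine Finset.sum_congr rfl fun l _ => ?_
  rw [← integral_norm_sq_fourier, ofReal_integral_eq_lintegral_ofReal]
  · refine lintegral_congr fun ξ => ?_
    rw [ENNReal.ofReal_pow (norm_nonneg _), ofReal_norm]
  · exact ((𝓕 (f l)).memLp 2).integrable_norm_pow (by simp)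
  · exact .of_forall fun ξ => by positivity

namespace LPFunction

variable {n : ℕ} {φ : Ell n → ℝ}

lemma ofReal_deltaL2_sq (hφ : LPFunction φ) (j : ℤ) (u : Fin n → 𝓢(Ell n, ℝ)) :
    ENNReal.ofReal (DeltaL2 φ j fun l => u l) ^ 2 =
      ∑ l, ∫⁻ ξ, ‖(φ ((2 : ℝ) ^ (-j) • ξ) : ℂ) * 𝓕 (complexify (u l)) ξ‖ₑ ^ 2 := by
  have h := ofReal_vL2_sq fun l =>
    𝓕⁻ (schwartzMul (dilate hφ.2.1 hφ.contDiff j) (𝓕 (complexify (u l))))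
  simp only [← hφ.deltaJ_coe, FourierTransform.fourier_fourierInv_eq, schwartzMul_apply,
    dilate_apply, ← cf_coe] at h
  exact h

/-- Bernstein's inequality `‖∇u‖_∞ ≲ ‖u‖_{Ḃ^{n/2+1}_{2,1}}` on the Fourier side. -/
lemma exists_lintegral_norm_mul_fourier_le (hφ : LPFunction φ) :
    ∃ K : ℝ≥0, ∀ (u : Fin n → 𝓢(Ell n, ℝ)) (l : Fin n),
      ∫⁻ ξ, ‖ξ‖ₑ * ‖𝓕 (complexify (u l)) ξ‖ₑ ≤
        K * ∑' j : ℤ, ENNReal.ofReal ((2 : ℝ) ^ ((j : ℝ) * ((n : ℝ) / 2 + 1)) *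
          DeltaL2 φ j fun l => u l) := by
  set V := (volume : Measure (Ell n)) (Metric.closedBall 0 1) with hV
  have hVt : V ≠ ⊤ := measure_closedBall_lt_top.ne
  set M : ℝ≥0 := (8 / 3) ^ (n + 2) * V.toNNReal + 1 with hM
  have hφc : Continuous φ := hφ.contDiff.continuous
  refine ⟨3 * M, fun u l => ?_⟩
  set a := 𝓕 (complexify (u l)) with ha
  have hblock (j : ℤ) : ∫⁻ ξ, ‖ξ‖ₑ * ‖(φ ((2 : ℝ) ^ (-j) • ξ) : ℂ) * a ξ‖ₑ ≤
      M * ENNReal.ofReal ((2 : ℝ) ^ ((j : ℝ) * ((n : ℝ) / 2 + 1)) * DeltaL2 φ j fun l => u l) := by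
    set R : ℝ := 8 / 3 * 2 ^ j with hR
    have hR0 : 0 ≤ R := by positivity
    rw [← ENNReal.pow_le_pow_left_iff two_ne_zero]
    have h1 : ∫⁻ ξ, ‖ξ‖ₑ * ‖(φ ((2 : ℝ) ^ (-j) • ξ) : ℂ) * a ξ‖ₑ ≤
        ∫⁻ ξ, (Metric.closedBall (0 : Ell n) R).indicator (fun _ => ENNReal.ofReal R) ξ *
          ‖(φ ((2 : ℝ) ^ (-j) • ξ) : ℂ) * a ξ‖ₑ := by
      refine lintegral_mono fun ξ => ?_
      by_cases h : φ ((2 : ℝ) ^ (-j) • ξ) = 0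
      · simp only [h, Complex.ofReal_zero, zero_mul, enorm_zero, mul_zero, le_refl]
      · have h2 := (hφ.annulus_dilate h).2
        rw [Set.indicator_of_mem (by simpa using h2)]
        gcongr
        rw [← ofReal_norm]
        exact ENNReal.ofReal_le_ofReal h2
    have h2 : ∫⁻ ξ, (Metric.closedBall (0 : Ell n) R).indicator
        (fun _ => ENNReal.ofReal R) ξ ^ 2 = ENNReal.ofReal (R ^ (n + 2)) * V := by
      have : (fun ξ => (Metric.closedBall (0 : Ell n) R).indicator
          (fun _ => ENNReal.ofReal R) ξ ^ 2) =
          (Metric.closedBall (0 : Ell n) R).indicator (fun _ => ENNReal.ofReal R ^ 2) := by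
        ext ξ
        by_cases h : ξ ∈ Metric.closedBall (0 : Ell n) R <;> simp [h]
      rw [this, lintegral_indicator_const Metric.isClosed_closedBall.measurableSet,
        Measure.addHaar_closedBall' _ _ hR0, ← mul_assoc, finrank_euclideanSpace_fin,
        ← ENNReal.ofReal_pow hR0, ← ENNReal.ofReal_mul (by positivity), ← pow_add, add_comm 2 n]
    have h3 : ∫⁻ ξ, ‖(φ ((2 : ℝ) ^ (-j) • ξ) : ℂ) * a ξ‖ₑ ^ 2 ≤
        ENNReal.ofReal (DeltaL2 φ j fun l => u l) ^ 2 := by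
      rw [hφ.ofReal_deltaL2_sq]
      exact Finset.single_le_sum (f := fun l => ∫⁻ ξ,
        ‖(φ ((2 : ℝ) ^ (-j) • ξ) : ℂ) * 𝓕 (complexify (u l)) ξ‖ₑ ^ 2) (fun _ _ => zero_le)
        (Finset.mem_univ l)
    have h4 : ENNReal.ofReal (R ^ (n + 2)) * V ≤
        (M * ENNReal.ofReal ((2 : ℝ) ^ ((j : ℝ) * ((n : ℝ) / 2 + 1)))) ^ 2 := by
      have h5 : ((2 : ℝ) ^ ((j : ℝ) * ((n : ℝ) / 2 + 1))) ^ 2 = ((2 : ℝ) ^ j) ^ (n + 2) := by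
        rw [← Real.rpow_mul_natCast (by norm_num), ← Real.rpow_intCast,
          ← Real.rpow_mul_natCast (by norm_num)]
        congr 1
        push_cast
        ring
      rw [mul_pow (M : ℝ≥0∞), ← ENNReal.ofReal_pow (by positivity), h5, hR, mul_pow,
        ENNReal.ofReal_mul (by positivity), mul_right_comm]
      gcongr
      have h6 : ENNReal.ofReal ((8 / 3) ^ (n + 2)) * V =
          (((8 / 3) ^ (n + 2) * V.toNNReal : ℝ≥0) : ℝ≥0∞) := by
        rw [ENNReal.coe_mul, ENNReal.coe_toNNReal hVt]
        congr 1
        rw [ENNReal.ofReal, ENNReal.coe_inj, Real.toNNReal_pow (by norm_num)]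
        congr 1
        ext
        norm_num
      rw [h6, hM]
      norm_cast
      exact (le_add_of_nonneg_right zero_le_one).trans (le_self_pow₀ (by simp) two_ne_zero)
    calc _ ≤ _ := pow_le_pow_left' h1 2
      _ ≤ _ := sq_lintegral_mul_le
        ((measurable_const.indicator Metric.isClosed_closedBall.measurableSet).aemeasurable)
        (by fun_prop)
      _ ≤ _ := mul_le_mul' (h2.trans_le h4) h3
      _ = _ := by rw [← mul_pow, mul_assoc, ← ENNReal.ofReal_mul (by positivity)]
  calc ∫⁻ ξ, ‖ξ‖ₑ * ‖a ξ‖ₑ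
      ≤ ∫⁻ ξ, 3 * ∑' j : ℤ, ‖ξ‖ₑ * ‖(φ ((2 : ℝ) ^ (-j) • ξ) : ℂ) * a ξ‖ₑ := by
        refine lintegral_mono fun ξ => ?_
        rcases eq_or_ne ξ 0 with rfl | h
        · simp
        · obtain ⟨j, hj⟩ := hφ.exists_third_le h
          refine le_trans ?_ (mul_le_mul_right (ENNReal.le_tsum j) _)
          rw [mul_left_comm]
          gcongr
          exact enorm_le_three_mul hj _
    _ = 3 * ∑' j : ℤ, ∫⁻ ξ, ‖ξ‖ₑ * ‖(φ ((2 : ℝ) ^ (-j) • ξ) : ℂ) * a ξ‖ₑ := by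
        rw [lintegral_const_mul' _ _ (by simp), lintegral_tsum fun j => by fun_prop]
    _ ≤ _ := by
        push_cast
        rw [mul_assoc, ← ENNReal.tsum_mul_left (a := (M : ℝ≥0∞))]
        exact mul_le_mul_right (ENNReal.tsum_le_tsum hblock) _

end LPFunction

/-- The sum of the absolute values of the components of `û`. -/
def amplitude {n : ℕ} (u : Fin n → 𝓢(Ell n, ℝ)) (ξ : Ell n) : ℝ≥0∞ :=
  ∑ i, ‖𝓕 (complexify (u i)) ξ‖ₑ

/-- The part of `amplitude u` at frequencies at least `3/8 * 2^k`. -/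
def highAmplitude {n : ℕ} (k : ℤ) (u : Fin n → 𝓢(Ell n, ℝ)) : Ell n → ℝ≥0∞ :=
  {ξ | 3 / 8 * (2 : ℝ) ^ k ≤ ‖ξ‖}.indicator (amplitude u)

lemma measurable_amplitude {n : ℕ} (u : Fin n → 𝓢(Ell n, ℝ)) : Measurable (amplitude u) := by
  unfold amplitude
  fun_prop

lemma measurable_highAmplitude {n : ℕ} (k : ℤ) (u : Fin n → 𝓢(Ell n, ℝ)) :
    Measurable (highAmplitude k u) :=
  (measurable_amplitude u).indicator (measurableSet_le measurable_const measurable_norm)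

lemma enorm_fourier_le_amplitude {n : ℕ} (u : Fin n → 𝓢(Ell n, ℝ)) (i : Fin n) (ξ : Ell n) :
    ‖𝓕 (complexify (u i)) ξ‖ₑ ≤ amplitude u ξ :=
  Finset.single_le_sum (f := fun i => ‖𝓕 (complexify (u i)) ξ‖ₑ) (fun _ _ => zero_le)
    (Finset.mem_univ i)

namespace LPFunction

variable {n : ℕ} {φ : Ell n → ℝ}

lemma lintegral_highAmplitude_sq_le (hφ : LPFunction φ) (u : Fin n → 𝓢(Ell n, ℝ)) (k : ℤ) :
    ∫⁻ ξ, highAmplitude k u ξ ^ 2 ≤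
      n * 9 *
        (∑' j : ℤ, if k - 2 ≤ j then ENNReal.ofReal (DeltaL2 φ j fun l => u l) else 0) ^ 2 := by
  have hφc : Continuous φ := hφ.contDiff.continuous
  have hpt (ξ : Ell n) : highAmplitude k u ξ ^ 2 ≤ n * 9 * ∑' j : ℤ, if k - 2 ≤ j then
      ∑ l, ‖(φ ((2 : ℝ) ^ (-j) • ξ) : ℂ) * 𝓕 (complexify (u l)) ξ‖ₑ ^ 2 else 0 := by
    by_cases hξ : 3 / 8 * (2 : ℝ) ^ k ≤ ‖ξ‖
    · have hk : (0 : ℝ) < 2 ^ k := by positivity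
      have h0 : ξ ≠ 0 := by
        rintro rfl
        rw [norm_zero] at hξ
        linarith
      obtain ⟨j, hj⟩ := hφ.exists_third_le h0
      have hjk : k - 2 ≤ j := by
        by_contra! hc
        have h1 : (2 : ℝ) ^ j ≤ 2 ^ (k - 3) := zpow_le_zpow_right₀ (by norm_num) (by omega)
        rw [zpow_sub₀ (by norm_num)] at h1
        norm_num at h1
        have h2 := (hφ.annulus_dilate (show φ ((2 : ℝ) ^ (-j) • ξ) ≠ 0 by linarith)).2
        linarith
      refine le_trans ?_ (mul_le_mul_right (ENNReal.le_tsum j) _)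
      rw [if_pos hjk, highAmplitude, Set.indicator_of_mem (by exact hξ), mul_assoc, Finset.mul_sum]
      refine (ENNReal.sq_sum_le _ _).trans ?_
      rw [Finset.card_univ, Fintype.card_fin]
      gcongr with l
      refine (pow_le_pow_left' (enorm_le_three_mul hj _) 2).trans_eq ?_
      rw [mul_pow]
      norm_num
    · rw [highAmplitude, Set.indicator_of_notMem (by exact hξ)]
      simp
  refine (lintegral_mono hpt).trans ?_
  rw [lintegral_const_mul' _ _ (by finiteness), lintegral_tsum]
  · refine mul_le_mul_right (le_trans ?_ (ENNReal.tsum_sq_le _)) _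
    refine ENNReal.tsum_le_tsum fun j => ?_
    split_ifs
    · rw [lintegral_finsetSum _ fun l _ => by fun_prop, hφ.ofReal_deltaL2_sq]
    · simp
  · intro j
    split_ifs <;> fun_prop

/-- The commutator of the statement as a Schwartz vector field. -/
def commutator (hφ : LPFunction φ) (u : Fin n → 𝓢(Ell n, ℝ)) (k : ℤ) (l : Fin n) :
    𝓢(Ell n, ℂ) :=
  𝓕⁻ (schwartzMul (dilate hφ.2.1 hφ.contDiff k)
      (𝓕 (∑ i, schwartzMul (complexify (u i)) (∂_{eVec n i} (complexify (u l)))))) -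
    ∑ i, schwartzMul
      (𝓕⁻ (schwartzMul (dilate hφ.hasCompactSupport_lowCutoff hφ.contDiff_lowCutoff (k - 1 - 1))
        (𝓕 (complexify (u i)))))
      (∂_{eVec n i} (𝓕⁻ (schwartzMul (dilate hφ.2.1 hφ.contDiff k) (𝓕 (complexify (u l))))))

lemma commutator_apply [NeZero n] (hφ : LPFunction φ) (u : Fin n → 𝓢(Ell n, ℝ)) (k : ℤ)
    (l : Fin n) (x : Ell n) :
    DeltaJ φ k (cf (fun y => ∑ i, u i y * fderiv ℝ (fun z => u l z) y (eVec n i))) x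
      - ∑ i, SJ φ (k - 1) (cf (u i)) x * pd i (DeltaJ φ k (cf (u l))) x =
    hφ.commutator u k l x := by
  rw [cf_advection]
  simp only [cf_coe, hφ.deltaJ_coe, hφ.sJ_coe, pd_coe, commutator, sub_apply, sum_apply,
    schwartzMul_apply]

lemma fourier_commutator (hφ : LPFunction φ) (u : Fin n → 𝓢(Ell n, ℝ)) (k : ℤ) (l : Fin n)
    (ξ : Ell n) :
    𝓕 (hφ.commutator u k l) ξ = ∑ i, ∫ η,
      ((φ ((2 : ℝ) ^ (-k) • ξ) - lowCutoff φ ((2 : ℝ) ^ (-(k - 1 - 1)) • (ξ - η)) *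
        φ ((2 : ℝ) ^ (-k) • η) : ℝ) : ℂ) *
      (𝓕 (complexify (u i)) (ξ - η) *
        (2 * Real.pi * Complex.I * (η i : ℂ) * 𝓕 (complexify (u l)) η)) := by
  have hint (f g : 𝓢(Ell n, ℂ)) : Integrable fun η => f (ξ - η) * g η := by
    obtain ⟨B, -, hB⟩ := f.decay 0 0
    exact g.integrable.bdd_mul (c := B) (by fun_prop)
      (.of_forall fun η => by simpa using hB (ξ - η))
  have hsum (f : Fin n → 𝓢(Ell n, ℂ)) : 𝓕 (∑ i, f i) = ∑ i, 𝓕 (f i) :=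
    map_sum (FourierTransform.fourierCLM ℂ 𝓢(Ell n, ℂ)) f _
  have hsub (f g : 𝓢(Ell n, ℂ)) : 𝓕 (f - g) = 𝓕 f - 𝓕 g :=
    map_sub (FourierTransform.fourierCLM ℂ 𝓢(Ell n, ℂ)) f g
  rw [commutator, hsub, hsum, FourierTransform.fourier_fourierInv_eq]
  simp only [sub_apply, sum_apply, schwartzMul_apply, hsum, fourier_schwartzMul]
  rw [Finset.mul_sum, ← Finset.sum_sub_distrib]
  refine Finset.sum_congr rfl fun i _ => ?_
  rw [← integral_const_mul, ← integral_sub ((hint _ _).const_mul _) (hint _ _)]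
  refine integral_congr_ae (.of_forall fun η => ?_)
  simp only [FourierTransform.fourier_fourierInv_eq, fourier_lineDeriv_eVec, schwartzMul_apply,
    dilate_apply]
  push_cast
  ring

/-- The Fourier transform of the commutator is dominated by a convolution. -/
lemma exists_enorm_fourier_commutator_le (hφ : LPFunction φ) :
    ∃ C : ℝ≥0, ∀ (u : Fin n → 𝓢(Ell n, ℝ)) (k : ℤ) (l : Fin n) (ξ : Ell n),
      ‖𝓕 (hφ.commutator u k l) ξ‖ₑ ≤
        C * ∫⁻ η, (‖ξ - η‖ₑ * amplitude u (ξ - η)) * highAmplitude k u η := by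
  obtain ⟨C, hC⟩ := hφ.exists_symbol_bound
  have hscale (k : ℤ) (ξ η : Ell n) :
      |φ ((2 : ℝ) ^ (-k) • ξ) - lowCutoff φ ((2 : ℝ) ^ (-(k - 1 - 1)) • (ξ - η)) *
        φ ((2 : ℝ) ^ (-k) • η)| * ‖η‖ ≤
      C * ((if 3 / 8 * (2 : ℝ) ^ k ≤ ‖η‖ then ‖ξ - η‖ else 0) +
        (if 3 / 8 * (2 : ℝ) ^ k ≤ ‖ξ - η‖ then ‖η‖ else 0)) := by
    have hk : (0 : ℝ) < 2 ^ k := by positivity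
    have h := hC ((2 : ℝ) ^ (-k) • ξ) ((2 : ℝ) ^ (-k) • η)
    have h4 : (4 : ℝ) * 2 ^ (-k) = 2 ^ (-(k - 1 - 1)) := by
      rw [show -(k - 1 - 1) = 2 + -k by ring, zpow_add₀ two_ne_zero]
      norm_num
    rw [← smul_sub, smul_smul, h4, norm_two_zpow_smul, norm_two_zpow_smul, zpow_neg] at h
    simp only [inv_mul_eq_div, le_div_iff₀ hk] at h
    rw [zpow_neg]
    refine le_of_mul_le_mul_left (h.trans_eq' ?_ |>.trans_eq ?_) (inv_pos.2 hk)
    · ring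
    · split_ifs <;> ring
  have hscale' (k : ℤ) (ξ η : Ell n) :
      ‖((φ ((2 : ℝ) ^ (-k) • ξ) - lowCutoff φ ((2 : ℝ) ^ (-(k - 1 - 1)) • (ξ - η)) *
        φ ((2 : ℝ) ^ (-k) • η) : ℝ) : ℂ)‖ₑ * ‖η‖ₑ ≤
      C * ((if 3 / 8 * (2 : ℝ) ^ k ≤ ‖η‖ then ‖ξ - η‖ₑ else 0) +
        (if 3 / 8 * (2 : ℝ) ^ k ≤ ‖ξ - η‖ then ‖η‖ₑ else 0)) := by
    rw [← ofReal_norm, Complex.norm_real, Real.norm_eq_abs, ← ofReal_norm, ← ofReal_norm,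
      ← ENNReal.ofReal_mul (abs_nonneg _)]
    refine (ENNReal.ofReal_le_ofReal (hscale k ξ η)).trans_eq ?_
    rw [ENNReal.ofReal_mul C.coe_nonneg, ENNReal.ofReal_add (by positivity) (by positivity)]
    simp only [apply_ite ENNReal.ofReal, ENNReal.ofReal_zero, ENNReal.ofReal_coe_nnreal]
  set P : ℝ≥0 := 2 * NNReal.pi * C with hP
  refine ⟨2 * P, fun u k l ξ => ?_⟩
  set G : Ell n → ℝ≥0∞ := fun p => ‖p‖ₑ * amplitude u p with hG
  have hGm : Measurable G := measurable_enorm.mul (measurable_amplitude u)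
  have hHm := measurable_highAmplitude k u
  have hpt (η : Ell n) : ∑ i, ‖((φ ((2 : ℝ) ^ (-k) • ξ) -
        lowCutoff φ ((2 : ℝ) ^ (-(k - 1 - 1)) • (ξ - η)) * φ ((2 : ℝ) ^ (-k) • η) : ℝ) : ℂ) *
      (𝓕 (complexify (u i)) (ξ - η) *
        (2 * Real.pi * Complex.I * (η i : ℂ) * 𝓕 (complexify (u l)) η))‖ₑ ≤
      P * (G (ξ - η) * highAmplitude k u η + highAmplitude k u (ξ - η) * G η) := by
    set m : ℝ := φ ((2 : ℝ) ^ (-k) • ξ) -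
      lowCutoff φ ((2 : ℝ) ^ (-(k - 1 - 1)) • (ξ - η)) * φ ((2 : ℝ) ^ (-k) • η) with hm
    have hpi : ‖(2 * Real.pi * Complex.I : ℂ)‖ₑ = (2 * NNReal.pi : ℝ≥0) := by
      rw [← ofReal_norm, ← ENNReal.ofReal_coe_nnreal]
      congr 1
      simp [abs_of_pos Real.pi_pos]
    have hterm (i : Fin n) : ‖(m : ℂ) * (𝓕 (complexify (u i)) (ξ - η) *
        (2 * Real.pi * Complex.I * (η i : ℂ) * 𝓕 (complexify (u l)) η))‖ₑ ≤
        (2 * NNReal.pi : ℝ≥0) * (‖(m : ℂ)‖ₑ * ‖η‖ₑ) * amplitude u η *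
          ‖𝓕 (complexify (u i)) (ξ - η)‖ₑ := by
      have hη : ‖(η i : ℂ)‖ₑ ≤ ‖η‖ₑ := by
        rw [enorm_le_iff_norm_le, Complex.norm_real]
        exact PiLp.norm_apply_le η i
      rw [enorm_mul, enorm_mul, enorm_mul, enorm_mul, hpi]
      calc _ ≤ ‖(m : ℂ)‖ₑ * (‖𝓕 (complexify (u i)) (ξ - η)‖ₑ *
            ((2 * NNReal.pi : ℝ≥0) * ‖η‖ₑ * amplitude u η)) := by
            gcongr
            exact enorm_fourier_le_amplitude u l η
        _ = _ := by ring
    refine (Finset.sum_le_sum fun i _ => hterm i).trans ?_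
    rw [← Finset.mul_sum]
    refine (mul_le_mul_left (mul_le_mul_left (mul_le_mul_right (hscale' k ξ η) _) _) _).trans_eq ?_
    have hPc : (P : ℝ≥0∞) = (2 * NNReal.pi : ℝ≥0) * C := by rw [hP, ENNReal.coe_mul]
    rw [hPc]
    generalize ((2 * NNReal.pi : ℝ≥0) : ℝ≥0∞) = q
    simp only [highAmplitude, hG, Set.indicator_apply, Set.mem_ofPred_eq]
    change _ * amplitude u (ξ - η) = _
    split_ifs <;> ring
  rw [hφ.fourier_commutator]
  calc _ ≤ _ := enorm_sum_le _ _
    _ ≤ _ := Finset.sum_le_sum fun i _ => enorm_integral_le_lintegral_enorm _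
    _ = _ := (lintegral_finsetSum' _ fun i _ => ?_).symm
    _ ≤ _ := lintegral_mono hpt
    _ = P * ((∫⁻ η, G (ξ - η) * highAmplitude k u η) +
        ∫⁻ η, highAmplitude k u (ξ - η) * G η) := by
      rw [lintegral_const_mul' _ _ (by simp), lintegral_add_left (by fun_prop)]
    _ = P * ((∫⁻ η, G (ξ - η) * highAmplitude k u η) +
        ∫⁻ η, G (ξ - η) * highAmplitude k u η) := by
      congr 2
      rw [← lintegral_sub_left_eq_self _ ξ]
      simp only [sub_sub_cancel, mul_comm]
    _ = _ := by
      rw [← two_mul, ← mul_assoc]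
      push_cast
      rw [mul_comm (P : ℝ≥0∞)]
  have hφc : Continuous φ := hφ.contDiff.continuous
  have hlc : Continuous (lowCutoff φ) := hφ.contDiff_lowCutoff.continuous
  fun_prop

end LPFunction

lemma SchwartzMap.lintegral_sq_pow_mul_ne_top {n : ℕ} (f : 𝓢(Ell n, ℂ)) (N : ℕ) :
    ∫⁻ ξ, (‖ξ‖ₑ ^ N * ‖f ξ‖ₑ) ^ 2 ≠ ⊤ := by
  obtain ⟨B, -, hB⟩ := f.decay 0 0
  have hfB (ξ : Ell n) : ‖f ξ‖ ≤ B := by simpa using hB ξ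
  have hi : Integrable fun ξ => B * (‖ξ‖ ^ (2 * N) * ‖f ξ‖) := by
    simpa using (f.integrable_pow_mul volume (2 * N)).const_mul B
  refine ne_top_of_le_ne_top hi.lintegral_lt_top.ne (lintegral_mono fun ξ => ?_)
  rw [← ofReal_norm, ← ofReal_norm, ← ENNReal.ofReal_pow (norm_nonneg _),
    ← ENNReal.ofReal_mul (by positivity), ← ENNReal.ofReal_pow (by positivity)]
  refine ENNReal.ofReal_le_ofReal ?_
  calc (‖ξ‖ ^ N * ‖f ξ‖) ^ 2 = ‖f ξ‖ * (‖ξ‖ ^ (2 * N) * ‖f ξ‖) := by ring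
    _ ≤ _ := by gcongr; exact hfB ξ

/-- The weights `2^{ms}`, `m ≤ 2`, of the convolution in the frequency index. -/
def lowWeight (s : ℝ) (m : ℤ) : ℝ≥0∞ := if m ≤ 2 then ENNReal.ofReal (2 ^ ((m : ℝ) * s)) else 0

lemma tsum_lowWeight_ne_zero (s : ℝ) : ∑' m, lowWeight s m ≠ 0 := by
  refine (lt_of_lt_of_le ?_ (ENNReal.le_tsum (0 : ℤ))).ne'
  simp [lowWeight]

lemma two_rpow_neg_mul_le {s : ℝ} (hs : 1 ≤ s) (m : ℕ) :
    (2 : ℝ) ^ (-(m : ℝ) * s) ≤ (1 / 2) ^ m := by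
  rw [one_div, inv_pow, ← Real.rpow_natCast, ← Real.rpow_neg (by norm_num)]
  refine Real.rpow_le_rpow_of_exponent_le (by norm_num) ?_
  nlinarith [(m.cast_nonneg : (0 : ℝ) ≤ m)]

lemma tsum_lowWeight_ne_top {s : ℝ} (hs : 1 ≤ s) : ∑' m, lowWeight s m ≠ ⊤ := by
  have h : Summable fun m : ℤ => if m ≤ 2 then (2 : ℝ) ^ ((m : ℝ) * s) else 0 := by
    refine Summable.of_nat_of_neg ?_ ?_
    · refine summable_of_ne_finset_zero (s := Finset.range 3) fun m hm => if_neg ?_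
      rw [Finset.mem_range] at hm
      omega
    · refine Summable.of_nonneg_of_le (fun m => by positivity) (fun m => ?_) summable_geometric_two
      rw [if_pos (by omega)]
      push_cast
      exact two_rpow_neg_mul_le hs m
  refine ne_of_eq_of_ne (tsum_congr fun m => ?_) h.tsum_ofReal_ne_top
  rw [lowWeight, apply_ite ENNReal.ofReal, ENNReal.ofReal_zero]

lemma tsum_tsum_lowWeight_mul (s : ℝ) (β : ℤ → ℝ≥0∞) :
    ∑' k, ∑' j, lowWeight s (k - j) * β j = (∑' m, lowWeight s m) * ∑' j, β j := by
  rw [ENNReal.tsum_comm, ← ENNReal.tsum_mul_left]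
  refine tsum_congr fun j => ?_
  rw [ENNReal.tsum_mul_right]
  congr 1
  exact (Equiv.subRight j).tsum_eq (lowWeight s)

lemma tsum_tail_eq (s : ℝ) (δ : ℤ → ℝ) (k : ℤ) :
    ∑' j, (if k - 2 ≤ j then ENNReal.ofReal (δ j) else 0) =
      ENNReal.ofReal (2 ^ (-(k : ℝ) * s)) *
        ∑' j, lowWeight s (k - j) * ENNReal.ofReal (2 ^ ((j : ℝ) * s) * δ j) := by
  rw [← ENNReal.tsum_mul_left]
  refine tsum_congr fun j => ?_
  rw [lowWeight]
  by_cases h : k - 2 ≤ j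
  · rw [if_pos h, if_pos (by omega), ← ENNReal.ofReal_mul (by positivity),
      ← ENNReal.ofReal_mul (by positivity), ← mul_assoc, ← mul_assoc,
      ← Real.rpow_add two_pos, ← Real.rpow_add two_pos]
    push_cast
    rw [show -(k : ℝ) * s + ((k : ℝ) - j) * s + j * s = 0 by ring, Real.rpow_zero, one_mul]
  · rw [if_neg h, if_neg (by omega), zero_mul, mul_zero]

namespace LPFunction

variable {n : ℕ} {φ : Ell n → ℝ}

lemma exists_deltaL2_le (hφ : LPFunction φ) (u : Fin n → 𝓢(Ell n, ℝ)) (N : ℕ) :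
    ∃ M : ℝ, 0 ≤ M ∧ ∀ j : ℤ, DeltaL2 φ j (fun l => u l) ≤ M * (2 : ℝ) ^ (-(j : ℝ) * N) := by
  set Q : ℝ≥0∞ := ∑ l, ∫⁻ ξ, (‖ξ‖ₑ ^ N * ‖𝓕 (complexify (u l)) ξ‖ₑ) ^ 2 with hQ
  have hQt : Q ≠ ⊤ :=
    ENNReal.sum_ne_top.2 fun l _ => SchwartzMap.lintegral_sq_pow_mul_ne_top _ N
  refine ⟨(4 / 3) ^ N * √Q.toReal, by positivity, fun j => ?_⟩
  set c : ℝ := 4 / 3 * 2 ^ (-j) with hc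
  have hc0 : 0 ≤ c := by positivity
  have hφle (ξ : Ell n) : φ ((2 : ℝ) ^ (-j) • ξ) ≤ (c * ‖ξ‖) ^ N := by
    by_cases h : φ ((2 : ℝ) ^ (-j) • ξ) = 0
    · rw [h]
      positivity
    · refine (hφ.le_one _).trans (one_le_pow₀ ?_)
      have := (hφ.annulus h).1
      rw [norm_two_zpow_smul] at this
      rw [hc]
      linarith
  have hsq : ENNReal.ofReal (DeltaL2 φ j fun l => u l) ^ 2 ≤
      ENNReal.ofReal ((c ^ N * √Q.toReal) ^ 2) := by
    rw [hφ.ofReal_deltaL2_sq, mul_pow, Real.sq_sqrt ENNReal.toReal_nonneg,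
      ENNReal.ofReal_mul (by positivity), ENNReal.ofReal_toReal hQt, hQ, Finset.mul_sum]
    refine Finset.sum_le_sum fun l _ => ?_
    rw [← lintegral_const_mul' _ _ ENNReal.ofReal_ne_top]
    refine lintegral_mono fun ξ => ?_
    rw [ENNReal.ofReal_pow (by positivity), ← mul_pow, ← mul_assoc, enorm_mul]
    gcongr
    rw [← ofReal_norm, Complex.norm_real, Real.norm_of_nonneg (hφ.nonneg _), ← ofReal_norm,
      ← ENNReal.ofReal_pow (by positivity), ← ENNReal.ofReal_mul (by positivity), ← mul_pow]
    exact ENNReal.ofReal_le_ofReal (hφle ξ)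
  have h0 : 0 ≤ DeltaL2 φ j fun l => u l := Real.sqrt_nonneg _
  rw [← ENNReal.ofReal_pow h0, ENNReal.ofReal_le_ofReal_iff (by positivity)] at hsq
  refine (le_of_sq_le_sq hsq (by positivity)).trans_eq ?_
  rw [hc, mul_pow, Real.rpow_mul two_pos.le, Real.rpow_natCast, ← Int.cast_neg, Real.rpow_intCast]
  ring

lemma summable_besov (hφ : LPFunction φ) (u : Fin n → 𝓢(Ell n, ℝ)) :
    Summable fun j : ℤ => (2 : ℝ) ^ ((j : ℝ) * ((n : ℝ) / 2 + 1)) * DeltaL2 φ j fun l => u l := by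
  obtain ⟨M, hM, h⟩ := hφ.exists_deltaL2_le u 0
  obtain ⟨M₂, hM₂, h₂⟩ := hφ.exists_deltaL2_le u (n + 2)
  have hs : 1 ≤ (n : ℝ) / 2 + 1 := by linarith [(n.cast_nonneg : (0 : ℝ) ≤ n)]
  have h0 (j : ℤ) : 0 ≤ DeltaL2 φ j fun l => u l := Real.sqrt_nonneg _
  refine Summable.of_nat_of_neg ?_ ?_
  · refine Summable.of_nonneg_of_le (fun m => mul_nonneg (by positivity) (h0 _)) (fun m => ?_)
      (summable_geometric_two.mul_left M₂)
    calc _ ≤ (2 : ℝ) ^ (((m : ℤ) : ℝ) * ((n : ℝ) / 2 + 1)) *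
          (M₂ * (2 : ℝ) ^ (-((m : ℤ) : ℝ) * (n + 2 : ℕ))) := by gcongr; exact h₂ m
      _ = M₂ * (2 : ℝ) ^ (-(m : ℝ) * ((n : ℝ) / 2 + 1)) := by
        rw [mul_left_comm, ← Real.rpow_add two_pos]
        push_cast
        ring_nf
      _ ≤ _ := by gcongr; exact two_rpow_neg_mul_le hs m
  · refine Summable.of_nonneg_of_le (fun m => mul_nonneg (by positivity) (h0 _)) (fun m => ?_)
      (summable_geometric_two.mul_left M)
    have hm := h (-m)
    rw [Nat.cast_zero, mul_zero, Real.rpow_zero, mul_one] at hm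
    rw [mul_comm]
    push_cast
    gcongr
    exact two_rpow_neg_mul_le hs m

lemma exists_vL2_commutator_le (hφ : LPFunction φ) :
    ∃ K : ℝ≥0, ∀ (u : Fin n → 𝓢(Ell n, ℝ)) (k : ℤ),
      ENNReal.ofReal (vL2 fun l => hφ.commutator u k l) ≤
        K * (∑' j : ℤ, ENNReal.ofReal ((2 : ℝ) ^ ((j : ℝ) * ((n : ℝ) / 2 + 1)) *
          DeltaL2 φ j fun l => u l)) *
        ∑' j : ℤ, if k - 2 ≤ j then ENNReal.ofReal (DeltaL2 φ j fun l => u l) else 0 := by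
  obtain ⟨C, hC⟩ := hφ.exists_enorm_fourier_commutator_le
  obtain ⟨K, hK⟩ := hφ.exists_lintegral_norm_mul_fourier_le
  refine ⟨3 * n * C * (n * K), fun u k => ?_⟩
  set B := ∑' j : ℤ, ENNReal.ofReal ((2 : ℝ) ^ ((j : ℝ) * ((n : ℝ) / 2 + 1)) *
    DeltaL2 φ j fun l => u l)
  set S := ∑' j : ℤ, if k - 2 ≤ j then ENNReal.ofReal (DeltaL2 φ j fun l => u l) else 0
  have hG : ∫⁻ p, ‖p‖ₑ * amplitude u p ≤ n * K * B := by
    simp only [amplitude, Finset.mul_sum]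
    rw [lintegral_finsetSum _ fun i _ => by fun_prop]
    refine (Finset.sum_le_sum fun i _ => hK u i).trans_eq ?_
    rw [Finset.sum_const, Finset.card_univ, Fintype.card_fin, nsmul_eq_mul, mul_assoc]
  have hl (l : Fin n) : ∫⁻ ξ, ‖𝓕 (hφ.commutator u k l) ξ‖ₑ ^ 2 ≤
      (C : ℝ≥0∞) ^ 2 * ((n * K * B) ^ 2 * (n * 9 * S ^ 2)) := by
    calc _ ≤ ∫⁻ ξ, (C : ℝ≥0∞) ^ 2 *
          (∫⁻ η, (‖ξ - η‖ₑ * amplitude u (ξ - η)) * highAmplitude k u η) ^ 2 :=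
          lintegral_mono fun ξ => by rw [← mul_pow]; gcongr; exact hC u k l ξ
      _ = _ := lintegral_const_mul' _ _ (by finiteness)
      _ ≤ _ := by
        gcongr
        refine (lintegral_sq_convolution_le (G := fun p => ‖p‖ₑ * amplitude u p)
          (measurable_enorm.mul (measurable_amplitude u)) (measurable_highAmplitude k u)).trans ?_
        gcongr
        exact hφ.lintegral_highAmplitude_sq_le u k
  rw [← ENNReal.pow_le_pow_left_iff two_ne_zero, ofReal_vL2_sq]
  refine (Finset.sum_le_sum fun l _ => hl l).trans_eq ?_
  rw [Finset.sum_const, Finset.card_univ, Fintype.card_fin, nsmul_eq_mul]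
  push_cast
  ring

end LPFunction

/-- **Main Besov estimate (Proposition 10).** For a divergence-free Schwartz
vector field `u`, `‖Δ_k((u·∇)u) − Σᵢ (Ṡ_{k−1}uᵢ)∂ᵢ(Δ_k u)‖_{L²}
≤ c d_k 2^{−k(n/2+1)} ‖u‖²_{Ḃ^{n/2+1}_{2,1}}` with `Σ_k d_k = 1`, `d_k ≥ 0`. -/
theorem besov_nonlinear_estimate (n : ℕ) (hn : 1 ≤ n)
    (φ : Ell n → ℝ) (hφ : LPFunction φ) :
    ∃ c > (0 : ℝ), ∀ u : Fin n → 𝓢(Ell n, ℝ), DivFree u →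
      ∃ d : ℤ → ℝ, (∀ k, 0 ≤ d k) ∧ (∑' k : ℤ, d k) = 1 ∧
        ∀ k : ℤ,
          vL2 (fun l x =>
              DeltaJ φ k (cf (fun y => ∑ i, u i y
                  * fderiv ℝ (fun z => u l z) y (eVec n i))) x
                - ∑ i, SJ φ (k - 1) (cf (u i)) x * pd i (DeltaJ φ k (cf (u l))) x)
            ≤ c * d k * (2 : ℝ) ^ (-(k : ℝ) * ((n : ℝ) / 2 + 1))
                * Bnorm φ ((n : ℝ) / 2 + 1) (fun l x => u l x) ^ 2 := by
  have : NeZero n := ⟨by omega⟩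
  obtain ⟨K, hK⟩ := hφ.exists_vL2_commutator_le
  set s : ℝ := (n : ℝ) / 2 + 1 with hs
  have hs1 : 1 ≤ s := by linarith [(n.cast_nonneg : (0 : ℝ) ≤ n)]
  set T : ℝ≥0∞ := ∑' m, lowWeight s m with hT
  have hT0 : T ≠ 0 := tsum_lowWeight_ne_zero s
  have hTt : T ≠ ⊤ := tsum_lowWeight_ne_top hs1
  refine ⟨K * T.toReal + 1, by positivity, fun u _ => ?_⟩
  simp only [hφ.commutator_apply]
  set β : ℤ → ℝ≥0∞ := fun j => ENNReal.ofReal ((2 : ℝ) ^ ((j : ℝ) * s) * DeltaL2 φ j fun l => u l)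
    with hβ
  set B : ℝ≥0∞ := ∑' j, β j with hB
  have hBt : B ≠ ⊤ := (hφ.summable_besov u).tsum_ofReal_ne_top
  have hBnorm : Bnorm φ s (fun l x => u l x) = B.toReal := by
    have h0 (j : ℤ) : 0 ≤ (2 : ℝ) ^ ((j : ℝ) * s) * DeltaL2 φ j fun l => u l :=
      mul_nonneg (by positivity) (Real.sqrt_nonneg _)
    rw [hB, ← ENNReal.ofReal_tsum_of_nonneg h0 (hφ.summable_besov u),
      ENNReal.toReal_ofReal (tsum_nonneg h0)]
    rfl
  rw [hBnorm]
  set W : ℤ → ℝ≥0∞ := fun k => ∑' j, lowWeight s (k - j) * β j with hW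
  have hmain (k : ℤ) : ENNReal.ofReal (vL2 fun l => hφ.commutator u k l) ≤
      K * B * (ENNReal.ofReal (2 ^ (-(k : ℝ) * s)) * W k) := by
    have := hK u k
    rwa [tsum_tail_eq s] at this
  by_cases hB0 : B = 0
  · refine ⟨Pi.single 0 1,
      fun k => (Pi.single_nonneg.2 zero_le_one : (0 : ℤ → ℝ) ≤ Pi.single 0 1) k,
      tsum_pi_single 0 1, fun k => ?_⟩
    have h := hmain k
    rw [hB0, mul_zero, zero_mul, nonpos_iff_eq_zero, ENNReal.ofReal_eq_zero] at h
    simpa [hB0] using h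
  · have hTB0 : T * B ≠ 0 := mul_ne_zero hT0 hB0
    have hTBt : T * B ≠ ⊤ := ENNReal.mul_ne_top hTt hBt
    have hsum : ∑' k, W k / (T * B) = 1 := by
      simp only [div_eq_mul_inv]
      rw [ENNReal.tsum_mul_right, tsum_tsum_lowWeight_mul, ENNReal.mul_inv_cancel hTB0 hTBt]
    have hdt (k : ℤ) : W k / (T * B) ≠ ⊤ :=
      ne_top_of_le_ne_top ENNReal.one_ne_top (hsum ▸ ENNReal.le_tsum k)
    refine ⟨fun k => (W k / (T * B)).toReal, fun k => ENNReal.toReal_nonneg, ?_, fun k => ?_⟩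
    · rw [← ENNReal.tsum_toReal_eq hdt, hsum, ENNReal.toReal_one]
    · have hWk : W k = T * B * (W k / (T * B)) := (ENNReal.mul_div_cancel hTB0 hTBt).symm
      have h := hmain k
      rw [hWk] at h
      have h2 := ENNReal.toReal_mono (by finiteness [hdt k]) h
      rw [ENNReal.toReal_ofReal (by exact Real.sqrt_nonneg _)] at h2
      simp only [ENNReal.toReal_mul, ENNReal.coe_toReal] at h2
      rw [ENNReal.toReal_ofReal (by positivity)] at h2
      refine h2.trans ?_
      set d := (W k / (T * B)).toReal
      have hd : 0 ≤ d * (2 : ℝ) ^ (-(k : ℝ) * s) * B.toReal ^ 2 := by positivity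
      linarith

end
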